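/- arXiv:2410.21869 — 2 statements merged into one kernel-verified Lean document; each statement's English description precedes it below -/
import Mathlib

section
/- (Weight collapse at the optimum.) Under the cluster-centric DGP, if (f, W, β) globally minimizes the DIET instance-discrimination objective L(f, W, β) among all continuous encoders f: R^D → R^d, all classification heads W, and all β > 0, then the rows of W associated with samples of the same semantic class are equal: for all i, j ∈ I, 𝒞(i) = 𝒞(j) implies w_i = w_j. -/
open MeasureTheory Metric
open scoped RealInnerProductSpace BigOperators

/-- The uniform (surface) measure on the unit sphere of `ℝ^d`, obtained from the
Lebesgue measure on `EuclideanSpace ℝ (Fin d)`. -/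
noncomputable def sphereUniform (d : ℕ) :
    Measure (Metric.sphere (0 : EuclideanSpace ℝ (Fin d)) 1) :=
  (volume : Measure (EuclideanSpace ℝ (Fin d))).toSphere

/-- A finite system of vectors is an *affine generator system* of `ℝ^d` if every vector
is a linear combination of the system with coefficients summing to `1`. -/
def IsAffineGenerator {d : ℕ} {ι : Type} [Fintype ι]
    (v : ι → EuclideanSpace ℝ (Fin d)) : Prop :=
  ∀ x : EuclideanSpace ℝ (Fin d), ∃ α : ι → ℝ,
    (∑ c, α c = 1) ∧ x = ∑ c, α c • v c

/-- The DIET instance-discrimination objective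
`L(f, W, β) = E_{(x,I)}[ −ln( exp(β⟨w_I, f(x)⟩) / Σ_j exp(β⟨w_j, f(x)⟩) ) ]`,
where the instance label is uniform on `Idx` and, conditionally on the label `i`, the
latent `z` is distributed on the unit sphere according to the von Mises–Fisher density
proportional to `exp (κ ⟪v (Cl i), z⟫)` with respect to the uniform (surface) measure,
and `x = g z`. -/
noncomputable def dietLoss (d D : ℕ) {Cset Idx : Type} [Fintype Idx]
    (v : Cset → EuclideanSpace ℝ (Fin d)) (κ : ℝ) (Cl : Idx → Cset)
    (g : Metric.sphere (0 : EuclideanSpace ℝ (Fin d)) 1 → EuclideanSpace ℝ (Fin D))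
    (f : EuclideanSpace ℝ (Fin D) → EuclideanSpace ℝ (Fin d))
    (w : Idx → EuclideanSpace ℝ (Fin d)) (β : ℝ) : ℝ :=
  (Fintype.card Idx : ℝ)⁻¹ * ∑ i : Idx,
    ((∫ z : Metric.sphere (0 : EuclideanSpace ℝ (Fin d)) 1,
        Real.exp (κ * ⟪v (Cl i), (z : EuclideanSpace ℝ (Fin d))⟫)
        ∂(sphereUniform d))⁻¹ *
      ∫ z : Metric.sphere (0 : EuclideanSpace ℝ (Fin d)) 1,
        Real.exp (κ * ⟪v (Cl i), (z : EuclideanSpace ℝ (Fin d))⟫) *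
          (- Real.log (Real.exp (β * ⟪w i, f (g z)⟫) /
            ∑ j : Idx, Real.exp (β * ⟪w j, f (g z)⟫)))
        ∂(sphereUniform d))

open scoped Pointwise in
/-- The surface measure is invariant under linear isometries. -/
lemma sphereUniform_integral_comp {d : ℕ}
    (ρ : EuclideanSpace ℝ (Fin d) ≃ₗᵢ[ℝ] EuclideanSpace ℝ (Fin d))
    (h : EuclideanSpace ℝ (Fin d) → ℝ) (hh : Continuous h) :
    ∫ z : Metric.sphere (0 : EuclideanSpace ℝ (Fin d)) 1, h (ρ z) ∂(sphereUniform d) =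
      ∫ z : Metric.sphere (0 : EuclideanSpace ℝ (Fin d)) 1, h z ∂(sphereUniform d) := by
  let T : Metric.sphere (0 : EuclideanSpace ℝ (Fin d)) 1 →
      Metric.sphere (0 : EuclideanSpace ℝ (Fin d)) 1 := fun z => ⟨ρ z, by simp⟩
  have hT : Continuous T := by
    refine Continuous.subtype_mk ?_ _
    exact ρ.continuous.comp continuous_subtype_val
  have hmap : (sphereUniform d).map T = sphereUniform d := by
    ext s hs
    rw [Measure.map_apply hT.measurable hs]
    unfold sphereUniform
    rw [Measure.toSphere_apply' _ (hT.measurable hs), Measure.toSphere_apply' _ hs]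
    congr 1
    have hset : Set.Ioo (0 : ℝ) 1 • (Subtype.val '' (T ⁻¹' s)) =
        ρ ⁻¹' (Set.Ioo (0 : ℝ) 1 • (Subtype.val '' s)) := by
      ext x
      simp only [Set.mem_smul, Set.mem_image, Set.mem_preimage]
      constructor
      · rintro ⟨r, hr, _, ⟨z, hz, rfl⟩, rfl⟩
        exact ⟨r, hr, _, ⟨T z, hz, rfl⟩, by simp [T]⟩
      · rintro ⟨r, hr, _, ⟨z, hz, rfl⟩, hx⟩
        refine ⟨r, hr, _, ⟨⟨ρ.symm z, by simp⟩, ?_, rfl⟩, ?_⟩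
        · simpa [T] using hz
        · apply ρ.injective
          simpa using hx
    rw [hset]
    exact ρ.measurePreserving.measure_preimage_emb
      ρ.toHomeomorph.measurableEmbedding _
  conv_rhs => rw [← hmap]
  rw [integral_map hT.measurable.aemeasurable]
  exact (hh.comp continuous_subtype_val).aestronglyMeasurable

/-- The von Mises–Fisher normalizer does not depend on the mean direction. -/
lemma vmf_normalizer_eq {d : ℕ} (κ : ℝ) (a b : EuclideanSpace ℝ (Fin d)) (hab : ‖a‖ = ‖b‖) :
    ∫ z : Metric.sphere (0 : EuclideanSpace ℝ (Fin d)) 1,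
        Real.exp (κ * ⟪a, (z : EuclideanSpace ℝ (Fin d))⟫) ∂(sphereUniform d) =
    ∫ z : Metric.sphere (0 : EuclideanSpace ℝ (Fin d)) 1,
        Real.exp (κ * ⟪b, (z : EuclideanSpace ℝ (Fin d))⟫) ∂(sphereUniform d) := by
  let ρ := Submodule.reflection (Submodule.span ℝ {a - b})ᗮ
  have hρ : ρ a = b := Submodule.reflection_sub hab
  rw [← sphereUniform_integral_comp ρ (fun x => Real.exp (κ * ⟪b, x⟫)) (by fun_prop)]
  congr 1
  ext z
  rw [← hρ, ρ.inner_map_map]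

/-- Pointwise Gibbs inequality in unnormalized form. -/
lemma gibbs_aux {ι : Type} [Fintype ι] [Nonempty ι] (a b : ι → ℝ) :
    0 ≤ (∑ i, Real.exp (a i) * (-Real.log (Real.exp (b i) / ∑ j, Real.exp (b j)))) -
      ∑ i, Real.exp (a i) * (-Real.log (Real.exp (a i) / ∑ j, Real.exp (a j))) ∧
    ((∑ i, Real.exp (a i) * (-Real.log (Real.exp (b i) / ∑ j, Real.exp (b j)))) -
      ∑ i, Real.exp (a i) * (-Real.log (Real.exp (a i) / ∑ j, Real.exp (a j))) = 0 →
      ∀ i j, b i - b j = a i - a j) := by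
  have hA : 0 < ∑ j, Real.exp (a j) := Finset.sum_pos (fun _ _ => Real.exp_pos _) Finset.univ_nonempty
  have hB : 0 < ∑ j, Real.exp (b j) := Finset.sum_pos (fun _ _ => Real.exp_pos _) Finset.univ_nonempty
  set A := ∑ j, Real.exp (a j) with hAdef
  set B := ∑ j, Real.exp (b j) with hBdef
  set t : ι → ℝ := fun i => b i - a i + Real.log A - Real.log B with ht
  have hlog : ∀ (x y : ℝ), 0 < y → Real.log (Real.exp x / y) = x - Real.log y := by
    intro x y hy
    rw [Real.log_div (Real.exp_pos x).ne' hy.ne', Real.log_exp]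
  have hexp : ∀ i, Real.exp (a i) * Real.exp (t i) = Real.exp (b i) * (A / B) := by
    intro i
    rw [← Real.exp_add]
    have : a i + t i = b i + (Real.log A - Real.log B) := by simp only [ht]; ring
    rw [this, Real.exp_add, Real.exp_sub, Real.exp_log hA, Real.exp_log hB]
  have hsum : ∑ i, Real.exp (a i) * (Real.exp (t i) - 1) = 0 := by
    simp only [mul_sub, hexp, mul_one, Finset.sum_sub_distrib, ← Finset.sum_mul]
    rw [← hAdef, ← hBdef]
    field_simp
    ring
  have hF : (∑ i, Real.exp (a i) * (-Real.log (Real.exp (b i) / B))) -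
      ∑ i, Real.exp (a i) * (-Real.log (Real.exp (a i) / A)) =
      ∑ i, Real.exp (a i) * (Real.exp (t i) - 1 - t i) := by
    have : ∑ i, Real.exp (a i) * (Real.exp (t i) - 1 - t i) =
        ∑ i, Real.exp (a i) * (Real.exp (t i) - 1) - ∑ i, Real.exp (a i) * t i := by
      rw [← Finset.sum_sub_distrib]
      exact Finset.sum_congr rfl fun i _ => by ring
    rw [this, hsum, ← Finset.sum_sub_distrib, zero_sub, ← Finset.sum_neg_distrib]
    refine Finset.sum_congr rfl fun i _ => ?_
    rw [hlog _ _ hA, hlog _ _ hB]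
    simp only [ht]; ring
  rw [hF]
  have hnn : ∀ i ∈ Finset.univ, 0 ≤ Real.exp (a i) * (Real.exp (t i) - 1 - t i) := fun i _ =>
    mul_nonneg (Real.exp_pos _).le (by linarith [Real.add_one_le_exp (t i)])
  refine ⟨Finset.sum_nonneg hnn, fun h0 => ?_⟩
  have ht0 : ∀ i, t i = 0 := by
    intro i
    have := (Finset.sum_eq_zero_iff_of_nonneg hnn).1 h0 i (Finset.mem_univ i)
    by_contra hne
    have h1 := Real.add_one_lt_exp hne
    have h2 := (mul_eq_zero.1 this).resolve_left (Real.exp_pos _).ne'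
    linarith
  intro i j
  have hi := ht0 i
  have hj := ht0 j
  simp only [ht] at hi hj
  linarith

/-- **Weight collapse at the optimum.** If `(f, W, β)` globally minimizes the DIET
objective among all continuous encoders, all heads and all positive temperatures, then
rows of `W` associated with samples of the same semantic class are equal. -/
theorem diet_weight_collapse
    {d D : ℕ} {Cset Idx : Type} [Fintype Cset] [Fintype Idx]
    (v : Cset → EuclideanSpace ℝ (Fin d))
    (hv_norm : ∀ c, ‖v c‖ = 1)
    (hv_gen : IsAffineGenerator v)
    (Cl : Idx → Cset) (hCl : Function.Surjective Cl)
    (κ : ℝ) (hκ : 0 < κ)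
    (g : Metric.sphere (0 : EuclideanSpace ℝ (Fin d)) 1 → EuclideanSpace ℝ (Fin D))
    (hg_cont : Continuous g) (hg_inj : Function.Injective g)
    (f : EuclideanSpace ℝ (Fin D) → EuclideanSpace ℝ (Fin d))
    (w : Idx → EuclideanSpace ℝ (Fin d)) (β : ℝ)
    (hf_cont : Continuous f)
    (hβ : 0 < β)
    (hmin : ∀ (f' : EuclideanSpace ℝ (Fin D) → EuclideanSpace ℝ (Fin d))
      (w' : Idx → EuclideanSpace ℝ (Fin d)) (β' : ℝ), Continuous f' → 0 < β' →
      dietLoss d D v κ Cl g f w β ≤ dietLoss d D v κ Cl g f' w' β') :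
    ∀ i j, Cl i = Cl j → w i = w j := by
  classical
  intro i j hij
  rcases Nat.eq_zero_or_pos d with hd | hd
  · subst hd
    exact Subsingleton.elim _ _
  haveI : NeZero d := ⟨hd.ne'⟩
  haveI : Nonempty Idx := ⟨i⟩
  haveI : (sphereUniform d).IsOpenPosMeasure := by unfold sphereUniform; infer_instance
  haveI : IsFiniteMeasure (sphereUniform d) := by unfold sphereUniform; infer_instance
  have hint : ∀ h : Metric.sphere (0 : EuclideanSpace ℝ (Fin d)) 1 → ℝ, Continuous h →
      Integrable h (sphereUniform d) := fun h hh =>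
    hh.integrable_of_hasCompactSupport (HasCompactSupport.of_compactSpace h)
  -- the ideal encoder
  have hemb := hg_cont.isClosedEmbedding hg_inj
  obtain ⟨F, hF⟩ := ContinuousMap.exists_extension' (Y := EuclideanSpace ℝ (Fin d)) hemb
    ⟨fun z => (z : EuclideanSpace ℝ (Fin d)), continuous_subtype_val⟩
  have hF' : ∀ z, F (g z) = (z : EuclideanSpace ℝ (Fin d)) := fun z => congrFun hF z
  -- the normalizer
  set Z : ℝ := ∫ z : Metric.sphere (0 : EuclideanSpace ℝ (Fin d)) 1,
        Real.exp (κ * ⟪v (Cl i), (z : EuclideanSpace ℝ (Fin d))⟫) ∂(sphereUniform d) with hZ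
  have hZe : ∀ k, ∫ z : Metric.sphere (0 : EuclideanSpace ℝ (Fin d)) 1,
        Real.exp (κ * ⟪v (Cl k), (z : EuclideanSpace ℝ (Fin d))⟫) ∂(sphereUniform d) = Z :=
    fun k => vmf_normalizer_eq κ _ _ (by rw [hv_norm, hv_norm])
  have hZpos : 0 < Z := by
    refine Continuous.integral_pos_of_hasCompactSupport_nonneg_nonzero (by fun_prop)
      (HasCompactSupport.of_compactSpace _) (fun z => (Real.exp_pos _).le)
      (x := ⟨v (Cl i), by simp [hv_norm]⟩) (Real.exp_pos _).ne'
  let a : Metric.sphere (0 : EuclideanSpace ℝ (Fin d)) 1 → Idx → ℝ :=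
    fun z k => κ * ⟪v (Cl k), (z : EuclideanSpace ℝ (Fin d))⟫
  let b : Metric.sphere (0 : EuclideanSpace ℝ (Fin d)) 1 → Idx → ℝ :=
    fun z k => β * ⟪w k, f (g z)⟫
  have ha : ∀ k, Continuous fun z => a z k := fun k => by
    simp only [a]; fun_prop
  have hb : ∀ k, Continuous fun z => b z k := fun k => by
    simp only [b]; fun_prop
  have hterm : ∀ (c : Metric.sphere (0 : EuclideanSpace ℝ (Fin d)) 1 → Idx → ℝ),
      (∀ k, Continuous fun z => c z k) → ∀ k, Continuous fun z =>
        Real.exp (a z k) * (-Real.log (Real.exp (c z k) / ∑ l, Real.exp (c z l))) := by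
    intro c hc k
    have hpos : ∀ z, 0 < ∑ l, Real.exp (c z l) := fun z =>
      Finset.sum_pos (fun _ _ => Real.exp_pos _) Finset.univ_nonempty
    refine (Real.continuous_exp.comp (ha k)).mul (Continuous.neg (Continuous.log ?_ ?_))
    · refine Continuous.div (Real.continuous_exp.comp (hc k)) ?_ (fun z => (hpos z).ne')
      exact continuous_finset_sum _ fun l _ => Real.continuous_exp.comp (hc l)
    · exact fun z => (div_pos (Real.exp_pos _) (hpos z)).ne'
  have hle : ∑ k, ∫ z, Real.exp (a z k) * (-Real.log (Real.exp (b z k) / ∑ l, Real.exp (b z l)))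
        ∂(sphereUniform d) ≤
      ∑ k, ∫ z, Real.exp (a z k) * (-Real.log (Real.exp (a z k) / ∑ l, Real.exp (a z l)))
        ∂(sphereUniform d) := by
    have h := hmin F (fun k => v (Cl k)) κ F.continuous hκ
    unfold dietLoss at h
    simp only [hZe, hF', ← Finset.mul_sum] at h
    have hN : (0 : ℝ) < (Fintype.card Idx : ℝ)⁻¹ := by
      have : 0 < Fintype.card Idx := Fintype.card_pos
      positivity
    exact le_of_mul_le_mul_left (le_of_mul_le_mul_left h hN) (inv_pos.2 hZpos)
  let G : Metric.sphere (0 : EuclideanSpace ℝ (Fin d)) 1 → ℝ := fun z =>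
    (∑ k, Real.exp (a z k) * (-Real.log (Real.exp (b z k) / ∑ l, Real.exp (b z l)))) -
      ∑ k, Real.exp (a z k) * (-Real.log (Real.exp (a z k) / ∑ l, Real.exp (a z l)))
  have hGc : Continuous G :=
    (continuous_finset_sum _ fun k _ => hterm b hb k).sub
      (continuous_finset_sum _ fun k _ => hterm a ha k)
  have hGnn : 0 ≤ G := fun z => (gibbs_aux (a z) (b z)).1
  have hGint : ∫ z, G z ∂(sphereUniform d) ≤ 0 := by
    simp only [G]
    rw [integral_sub, integral_finset_sum, integral_finset_sum]
    · linarith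
    · exact fun k _ => hint _ (hterm a ha k)
    · exact fun k _ => hint _ (hterm b hb k)
    · exact hint _ (continuous_finset_sum _ fun k _ => hterm b hb k)
    · exact hint _ (continuous_finset_sum _ fun k _ => hterm a ha k)
  have hG0 : G = 0 := by
    have h0 : ∫ z, G z ∂(sphereUniform d) = 0 := le_antisymm hGint (integral_nonneg hGnn)
    have hae := (integral_eq_zero_iff_of_nonneg hGnn (hint G hGc)).1 h0
    exact (hGc.ae_eq_iff_eq _ continuous_zero).1 hae
  have hkey : ∀ z k l, β * ⟪w k, f (g z)⟫ - β * ⟪w l, f (g z)⟫ =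
      κ * ⟪v (Cl k), (z : EuclideanSpace ℝ (Fin d))⟫ -
        κ * ⟪v (Cl l), (z : EuclideanSpace ℝ (Fin d))⟫ := fun z k l =>
    (gibbs_aux (a z) (b z)).2 (congrFun hG0 z) k l
  -- a vector orthogonal to the sphere vanishes
  have hsph : ∀ x : EuclideanSpace ℝ (Fin d),
      (∀ z : Metric.sphere (0 : EuclideanSpace ℝ (Fin d)) 1,
        ⟪x, (z : EuclideanSpace ℝ (Fin d))⟫ = 0) → x = 0 := by
    intro x hx
    by_contra hne
    have h := hx ⟨‖x‖⁻¹ • x, by simp [norm_smul, hne]⟩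
    simp [inner_smul_right, hne] at h
  -- every linear functional of the latent is a linear functional of the representation
  choose s hs using hCl
  have hex : ∀ x : EuclideanSpace ℝ (Fin d), ∃ y : EuclideanSpace ℝ (Fin d),
      ∀ z : Metric.sphere (0 : EuclideanSpace ℝ (Fin d)) 1,
        κ * ⟪x, (z : EuclideanSpace ℝ (Fin d))⟫ = β * ⟪y, f (g z)⟫ := by
    intro x
    obtain ⟨α, hα, hx⟩ := hv_gen x
    obtain ⟨α', hα', h0⟩ := hv_gen 0
    refine ⟨∑ c, (α c - α' c) • w (s c), fun z => ?_⟩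
    have hx' : x = ∑ c, (α c - α' c) • v c := by
      simp only [sub_smul, Finset.sum_sub_distrib]
      rw [← hx, ← h0, sub_zero]
    have hγ : ∑ c, (α c - α' c) = 0 := by
      rw [Finset.sum_sub_distrib, hα, hα', sub_self]
    have hk : ∀ c, κ * ⟪v c, (z : EuclideanSpace ℝ (Fin d))⟫ = β * ⟪w (s c), f (g z)⟫ +
        (κ * ⟪v (Cl i), (z : EuclideanSpace ℝ (Fin d))⟫ - β * ⟪w i, f (g z)⟫) := by
      intro c
      have := hkey z (s c) i
      rw [hs] at this
      linarith
    rw [hx', sum_inner, sum_inner, Finset.mul_sum, Finset.mul_sum]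
    simp only [real_inner_smul_left]
    have : ∀ c, κ * ((α c - α' c) * ⟪v c, (z : EuclideanSpace ℝ (Fin d))⟫) =
        β * ((α c - α' c) * ⟪w (s c), f (g z)⟫) + (α c - α' c) *
        (κ * ⟪v (Cl i), (z : EuclideanSpace ℝ (Fin d))⟫ - β * ⟪w i, f (g z)⟫) := by
      intro c
      linear_combination (α c - α' c) * hk c
    simp only [this]
    rw [Finset.sum_add_distrib, ← Finset.sum_mul, hγ, zero_mul, add_zero]
  choose y hy using hex
  let B := (EuclideanSpace.basisFun (Fin d) ℝ).toBasis
  let Y : EuclideanSpace ℝ (Fin d) →ₗ[ℝ] EuclideanSpace ℝ (Fin d) :=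
    B.constr ℝ (fun k => y (B k))
  have hY : ∀ x (z : Metric.sphere (0 : EuclideanSpace ℝ (Fin d)) 1),
      κ * ⟪x, (z : EuclideanSpace ℝ (Fin d))⟫ = β * ⟪Y x, f (g z)⟫ := by
    intro x z
    have hYx : Y x = ∑ k, B.repr x k • y (B k) := by
      simp only [Y, Module.Basis.constr_apply_fintype, Module.Basis.equivFun_apply]
    conv_lhs => rw [← B.sum_repr x]
    rw [hYx, sum_inner, sum_inner, Finset.mul_sum, Finset.mul_sum]
    refine Finset.sum_congr rfl fun k _ => ?_
    rw [real_inner_smul_left, real_inner_smul_left]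
    linear_combination (B.repr x k) * hy (B k) z
  have hYinj : Function.Injective Y := by
    rw [injective_iff_map_eq_zero]
    intro x hx
    refine hsph x fun z => ?_
    have := hY x z
    rw [hx, inner_zero_left, mul_zero] at this
    exact (mul_eq_zero.1 this).resolve_left hκ.ne'
  obtain ⟨x, hx⟩ := (LinearMap.injective_iff_surjective.1 hYinj) (w i - w j)
  have hx0 : x = 0 := by
    refine hsph x fun z => ?_
    have h1 := hY x z
    have h2 := hkey z i j
    rw [hij, sub_self] at h2
    rw [hx, inner_sub_left, mul_sub, h2] at h1
    exact (mul_eq_zero.1 h1).resolve_left hκ.ne'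
  rw [hx0, map_zero] at hx
  exact (sub_eq_zero.1 hx.symm)
end

section
/- (Theorem 2: identifiability of supervised classification.) Under the supervised cluster-centric DGP, suppose a continuous encoder f: R^D → R^d, a linear classifier W with rows {w_c^T : c ∈ 𝒞set}, and β > 0 globally minimize the supervised cross-entropy objective L(f, W, β) = E_{(x, C)}[ −ln( exp(β⟨w_C, f(x)⟩) / Σ_{c'∈𝒞set} exp(β⟨w_{c'}, f(x)⟩) ) ] among all continuous encoders, linear classifiers, and positive temperatures. Then the composition h = f ∘ g is a linear map from S^{d-1} to R^d; more precisely, there exists an invertible linear map A: R^d → R^d such that h(z) = A^{-1} z for all z ∈ S^{d-1}. -/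
open MeasureTheory Metric
open scoped RealInnerProductSpace BigOperators

/-- The supervised cross-entropy objective
`L(f, W, β) = E_{(x,C)}[ −ln( exp(β⟨w_C, f(x)⟩) / Σ_{c'} exp(β⟨w_{c'}, f(x)⟩) ) ]`,
where the class label `C` is uniform on `Cset` and, conditionally on `C = c`, the latent
`z` is distributed on the unit sphere according to the von Mises–Fisher density
proportional to `exp (κ ⟪v c, z⟫)` with respect to the uniform (surface) measure, and
`x = g z`. -/
noncomputable def supervisedLoss (d D : ℕ) {Cset : Type} [Fintype Cset]
    (v : Cset → EuclideanSpace ℝ (Fin d)) (κ : ℝ)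
    (g : Metric.sphere (0 : EuclideanSpace ℝ (Fin d)) 1 → EuclideanSpace ℝ (Fin D))
    (f : EuclideanSpace ℝ (Fin D) → EuclideanSpace ℝ (Fin d))
    (w : Cset → EuclideanSpace ℝ (Fin d)) (β : ℝ) : ℝ :=
  (Fintype.card Cset : ℝ)⁻¹ * ∑ c : Cset,
    ((∫ z : Metric.sphere (0 : EuclideanSpace ℝ (Fin d)) 1,
        Real.exp (κ * ⟪v c, (z : EuclideanSpace ℝ (Fin d))⟫)
        ∂(sphereUniform d))⁻¹ *
      ∫ z : Metric.sphere (0 : EuclideanSpace ℝ (Fin d)) 1,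
        Real.exp (κ * ⟪v c, (z : EuclideanSpace ℝ (Fin d))⟫) *
          (- Real.log (Real.exp (β * ⟪w c, f (g z)⟫) /
            ∑ c' : Cset, Real.exp (β * ⟪w c', f (g z)⟫)))
        ∂(sphereUniform d))

/-- The Gibbs inequality together with its equality case, pointwise in terms of logits. -/
lemma gibbs_aux_s5 {ι : Type} [Fintype ι] (p q : ι → ℝ) (hp : ∀ c, 0 < p c) (hq : ∀ c, 0 < q c)
    (hs : ∑ c, p c = ∑ c, q c) :
    ∑ c, p c * (-Real.log (p c)) ≤ ∑ c, p c * (-Real.log (q c)) ∧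
    (∑ c, p c * (-Real.log (p c)) = ∑ c, p c * (-Real.log (q c)) → ∀ c, p c = q c) := by
  have key : ∀ c, p c * (-Real.log (p c)) - p c * (-Real.log (q c)) ≤ q c - p c := by
    intro c
    have h := Real.log_le_sub_one_of_pos (div_pos (hq c) (hp c))
    rw [Real.log_div (hq c).ne' (hp c).ne'] at h
    have h2 := mul_le_mul_of_nonneg_left h (hp c).le
    have h3 : p c * (q c / p c - 1) = q c - p c := by
      have := (hp c).ne'
      field_simp
    linarith
  have key2 : ∀ c, p c ≠ q c →
      p c * (-Real.log (p c)) - p c * (-Real.log (q c)) < q c - p c := by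
    intro c hne
    have hne' : q c / p c ≠ 1 := by
      intro h
      rw [div_eq_one_iff_eq (hp c).ne'] at h
      exact hne h.symm
    have h := Real.log_lt_sub_one_of_pos (div_pos (hq c) (hp c)) hne'
    rw [Real.log_div (hq c).ne' (hp c).ne'] at h
    have h2 := mul_lt_mul_of_pos_left h (hp c)
    have h3 : p c * (q c / p c - 1) = q c - p c := by
      have := (hp c).ne'
      field_simp
    linarith
  have hz : ∑ c, (q c - p c) = 0 := by
    rw [Finset.sum_sub_distrib, hs, sub_self]
  constructor
  · have := Finset.sum_le_sum (fun c (_ : c ∈ Finset.univ) => key c)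
    rw [hz, Finset.sum_sub_distrib] at this
    linarith
  · intro he c
    by_contra hne
    have := Finset.sum_lt_sum (fun c (_ : c ∈ Finset.univ) => key c) ⟨c, Finset.mem_univ c, key2 c hne⟩
    rw [hz, Finset.sum_sub_distrib] at this
    linarith

lemma gibbs_logits {ι : Type} [Fintype ι] [Nonempty ι] (a b : ι → ℝ) :
    ∑ c, Real.exp (a c) * (-Real.log (Real.exp (a c) / ∑ c', Real.exp (a c'))) ≤
      ∑ c, Real.exp (a c) * (-Real.log (Real.exp (b c) / ∑ c', Real.exp (b c'))) ∧
    (∑ c, Real.exp (a c) * (-Real.log (Real.exp (a c) / ∑ c', Real.exp (a c'))) =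
      ∑ c, Real.exp (a c) * (-Real.log (Real.exp (b c) / ∑ c', Real.exp (b c'))) →
      ∀ c c₀, b c - b c₀ = a c - a c₀) := by
  have hA : 0 < ∑ c', Real.exp (a c') :=
    Finset.sum_pos (fun c _ => Real.exp_pos _) Finset.univ_nonempty
  have hB : 0 < ∑ c', Real.exp (b c') :=
    Finset.sum_pos (fun c _ => Real.exp_pos _) Finset.univ_nonempty
  set A := ∑ c', Real.exp (a c') with hAdef
  set B := ∑ c', Real.exp (b c') with hBdef
  obtain ⟨h1, h2⟩ := gibbs_aux_s5 (fun c => Real.exp (a c) / A) (fun c => Real.exp (b c) / B)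
    (fun c => div_pos (Real.exp_pos _) hA) (fun c => div_pos (Real.exp_pos _) hB)
    (by rw [← Finset.sum_div, ← Finset.sum_div, ← hAdef, ← hBdef, div_self hA.ne', div_self hB.ne'])
  have conv : ∀ t : ι → ℝ, ∑ c, Real.exp (a c) * t c = A * ∑ c, Real.exp (a c) / A * t c := by
    intro t
    rw [Finset.mul_sum]
    refine Finset.sum_congr rfl fun c _ => ?_
    field_simp
  rw [conv, conv (fun c => -Real.log (Real.exp (b c) / B))]
  refine ⟨mul_le_mul_of_nonneg_left h1 hA.le, fun he c c₀ => ?_⟩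
  have h3 := h2 (mul_left_cancel₀ hA.ne' he)
  have h4 : ∀ c, a c - Real.log A = b c - Real.log B := by
    intro c
    have := congrArg Real.log (h3 c)
    simpa [Real.log_div, hA.ne', hB.ne'] using this
  linarith [h4 c, h4 c₀]

/-- Invariance of the surface measure under linear isometries. -/
lemma sphere_invariant {d : ℕ} (e : EuclideanSpace ℝ (Fin d) ≃ₗᵢ[ℝ] EuclideanSpace ℝ (Fin d))
    (φ : EuclideanSpace ℝ (Fin d) → ℝ) :
    ∫ z : Metric.sphere (0 : EuclideanSpace ℝ (Fin d)) 1, φ (e z) ∂(sphereUniform d) =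
    ∫ z : Metric.sphere (0 : EuclideanSpace ℝ (Fin d)) 1, φ z ∂(sphereUniform d) := by
  let T : Metric.sphere (0 : EuclideanSpace ℝ (Fin d)) 1 ≃ₜ
      Metric.sphere (0 : EuclideanSpace ℝ (Fin d)) 1 :=
    { toFun := fun z => ⟨e z, by simp⟩
      invFun := fun z => ⟨e.symm z, by simp⟩
      left_inv := fun z => by simp
      right_inv := fun z => by simp
      continuous_toFun := by fun_prop
      continuous_invFun := by fun_prop }
  have hmap : Measure.map T (sphereUniform d) = sphereUniform d := by
    ext s hs
    have hTs : MeasurableSet (T ⁻¹' s) := T.measurable hs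
    rw [Measure.map_apply T.measurable hs, sphereUniform, Measure.toSphere_apply' _ hTs,
      Measure.toSphere_apply' _ hs]
    congr 1
    symm
    rw [← e.measurePreserving.measure_preimage_emb e.toHomeomorph.measurableEmbedding]
    symm
    congr 1
    ext x
    simp only [Set.mem_smul, Set.mem_image, Set.mem_preimage]
    constructor
    · rintro ⟨r, hr, _, ⟨z, hz, rfl⟩, rfl⟩
      exact ⟨r, hr, _, ⟨T z, hz, rfl⟩, by simp [T]⟩
    · rintro ⟨r, hr, _, ⟨z, hz, rfl⟩, h⟩
      refine ⟨r, hr, _, ⟨T.symm z, by simpa using hz, rfl⟩, ?_⟩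
      apply e.injective
      rw [← h]
      simp [T]
  have := T.measurableEmbedding.integral_map (μ := sphereUniform d)
    (fun z : Metric.sphere (0 : EuclideanSpace ℝ (Fin d)) 1 => φ z)
  rw [hmap] at this
  rw [this]
  rfl

/-- The von Mises-Fisher normalizing constant does not depend on the direction. -/
lemma vmf_const {d : ℕ} (κ : ℝ) (u v : EuclideanSpace ℝ (Fin d)) (h : ‖u‖ = ‖v‖) :
    ∫ z : Metric.sphere (0 : EuclideanSpace ℝ (Fin d)) 1,
        Real.exp (κ * ⟪u, (z : EuclideanSpace ℝ (Fin d))⟫) ∂(sphereUniform d) =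
    ∫ z : Metric.sphere (0 : EuclideanSpace ℝ (Fin d)) 1,
        Real.exp (κ * ⟪v, (z : EuclideanSpace ℝ (Fin d))⟫) ∂(sphereUniform d) := by
  set e := (Submodule.span ℝ {u - v})ᗮ.reflection with he
  have h1 : e u = v := Submodule.reflection_sub h
  rw [← sphere_invariant e (fun x => Real.exp (κ * ⟪v, x⟫))]
  refine integral_congr_ae (Filter.Eventually.of_forall fun z => ?_)
  simp only
  rw [← h1, e.inner_map_map]

/-- The linear algebra step. -/
lemma linear_step {d : ℕ} {ι : Type} [Fintype ι]
    (v w : ι → EuclideanSpace ℝ (Fin d)) (hv : IsAffineGenerator v) (κ β : ℝ) (hκ : 0 < κ)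
    (c₀ : ι)
    (h : Metric.sphere (0 : EuclideanSpace ℝ (Fin d)) 1 → EuclideanSpace ℝ (Fin d))
    (heq : ∀ z c, β * ⟪w c, h z⟫ - β * ⟪w c₀, h z⟫ =
      κ * ⟪v c, (z : EuclideanSpace ℝ (Fin d))⟫ - κ * ⟪v c₀, (z : EuclideanSpace ℝ (Fin d))⟫) :
    ∃ A : EuclideanSpace ℝ (Fin d) ≃ₗ[ℝ] EuclideanSpace ℝ (Fin d),
      ∀ z : Metric.sphere (0 : EuclideanSpace ℝ (Fin d)) 1,
        h z = A.symm (z : EuclideanSpace ℝ (Fin d)) := by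
  let V : EuclideanSpace ℝ (Fin d) →ₗ[ℝ] (ι → ℝ) :=
    LinearMap.pi fun c => (κ • (innerₗ _ (v c) - innerₗ _ (v c₀)))
  let W : EuclideanSpace ℝ (Fin d) →ₗ[ℝ] (ι → ℝ) :=
    LinearMap.pi fun c => (β • (innerₗ _ (w c) - innerₗ _ (w c₀)))
  have hV : ∀ x c, V x c = κ * ⟪v c, x⟫ - κ * ⟪v c₀, x⟫ := by
    intro x c; simp [V, mul_sub]
  have hW : ∀ x c, W x c = β * ⟪w c, x⟫ - β * ⟪w c₀, x⟫ := by
    intro x c; simp [W, mul_sub]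
  have hVW : ∀ z, W (h z) = V z := by
    intro z; ext c; rw [hV, hW, heq]
  have hVinj : Function.Injective V := by
    rw [injective_iff_map_eq_zero]
    intro z hz
    have h1 : ∀ c, ⟪v c, z⟫ = ⟪v c₀, z⟫ := by
      intro c
      have := congrFun hz c
      rw [hV] at this
      simp only [Pi.zero_apply] at this
      have h2 : κ * ⟪v c, z⟫ = κ * ⟪v c₀, z⟫ := by linarith
      exact mul_left_cancel₀ hκ.ne' h2
    have h2 : ∀ x : EuclideanSpace ℝ (Fin d), ⟪x, z⟫ = ⟪v c₀, z⟫ := by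
      intro x
      obtain ⟨α, hα, hx⟩ := hv x
      rw [hx, sum_inner]
      simp only [inner_smul_left, h1, RCLike.conj_to_real]
      rw [← Finset.sum_mul, hα, one_mul]
    have h3 := h2 0
    rw [inner_zero_left] at h3
    have h4 := h2 z
    rw [← h3] at h4
    exact inner_self_eq_zero.mp h4
  have hrange : ∀ x, V x ∈ LinearMap.range W := by
    intro x
    by_cases hx : x = 0
    · rw [hx, map_zero]; exact Submodule.zero_mem _
    · have hn : ‖x‖ ≠ 0 := norm_ne_zero_iff.mpr hx
      let z : Metric.sphere (0 : EuclideanSpace ℝ (Fin d)) 1 :=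
        ⟨‖x‖⁻¹ • x, by simp [norm_smul, hn]⟩
      have : x = ‖x‖ • (z : EuclideanSpace ℝ (Fin d)) := by simp [z, smul_smul, hn]
      rw [this, map_smul, ← hVW]
      exact Submodule.smul_mem _ _ ⟨_, rfl⟩
  have hWinj : Function.Injective W := by
    have hle : LinearMap.range V ≤ LinearMap.range W := by
      rintro _ ⟨x, rfl⟩; exact hrange x
    have h1 := Submodule.finrank_mono hle
    rw [LinearMap.finrank_range_of_inj hVinj] at h1
    have h2 := LinearMap.finrank_range_add_finrank_ker W
    rw [← LinearMap.ker_eq_bot, ← Submodule.finrank_eq_zero (R := ℝ)]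
    omega
  let T : EuclideanSpace ℝ (Fin d) →ₗ[ℝ] EuclideanSpace ℝ (Fin d) :=
    (LinearEquiv.ofInjective W hWinj).symm.toLinearMap ∘ₗ V.codRestrict (LinearMap.range W) hrange
  have hT : ∀ x, W (T x) = V x := by
    intro x
    have := congrArg Subtype.val
      ((LinearEquiv.ofInjective W hWinj).apply_symm_apply (V.codRestrict (LinearMap.range W) hrange x))
    simpa [T] using this
  have hTinj : Function.Injective T := by
    intro x y hxy
    apply hVinj
    rw [← hT, ← hT, hxy]
  refine ⟨(LinearEquiv.ofInjectiveEndo T hTinj).symm, fun z => ?_⟩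
  apply hWinj
  rw [hVW, LinearEquiv.symm_symm, LinearEquiv.coe_ofInjectiveEndo, hT]

/-- The loss as a single integral, using that all normalizing constants agree. -/
lemma loss_eq {d D : ℕ} {Cset : Type} [Fintype Cset] [Nonempty Cset]
    (v : Cset → EuclideanSpace ℝ (Fin d)) (hv : ∀ c, ‖v c‖ = 1) (κ : ℝ)
    (g : Metric.sphere (0 : EuclideanSpace ℝ (Fin d)) 1 → EuclideanSpace ℝ (Fin D))
    (hg : Continuous g)
    (c₀ : Cset)
    (f : EuclideanSpace ℝ (Fin D) → EuclideanSpace ℝ (Fin d)) (hf : Continuous f)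
    (w : Cset → EuclideanSpace ℝ (Fin d)) (β : ℝ) :
    Continuous (fun z : Metric.sphere (0 : EuclideanSpace ℝ (Fin d)) 1 => ∑ c,
      Real.exp (κ * ⟪v c, (z : EuclideanSpace ℝ (Fin d))⟫) *
          (- Real.log (Real.exp (β * ⟪w c, f (g z)⟫) /
            ∑ c' : Cset, Real.exp (β * ⟪w c', f (g z)⟫)))) ∧
    supervisedLoss d D v κ g f w β =
    (Fintype.card Cset : ℝ)⁻¹ *
    ((∫ z : Metric.sphere (0 : EuclideanSpace ℝ (Fin d)) 1,
        Real.exp (κ * ⟪v c₀, (z : EuclideanSpace ℝ (Fin d))⟫) ∂(sphereUniform d))⁻¹ *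
    ∫ z : Metric.sphere (0 : EuclideanSpace ℝ (Fin d)) 1, ∑ c,
      Real.exp (κ * ⟪v c, (z : EuclideanSpace ℝ (Fin d))⟫) *
          (- Real.log (Real.exp (β * ⟪w c, f (g z)⟫) /
            ∑ c' : Cset, Real.exp (β * ⟪w c', f (g z)⟫))) ∂(sphereUniform d)) := by
  haveI : IsFiniteMeasure (sphereUniform d) := by unfold sphereUniform; infer_instance
  have hB : ∀ z, 0 < ∑ c' : Cset, Real.exp (β * ⟪w c', f (g z)⟫) := fun z =>
    Finset.sum_pos (fun c _ => Real.exp_pos _) Finset.univ_nonempty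
  have hc : ∀ c, Continuous (fun z : Metric.sphere (0 : EuclideanSpace ℝ (Fin d)) 1 =>
      Real.exp (κ * ⟪v c, (z : EuclideanSpace ℝ (Fin d))⟫) *
          (- Real.log (Real.exp (β * ⟪w c, f (g z)⟫) /
            ∑ c' : Cset, Real.exp (β * ⟪w c', f (g z)⟫)))) := by
    intro c
    have hfg : Continuous fun z => f (g z) := hf.comp hg
    refine Continuous.mul (by fun_prop) (Continuous.neg (Continuous.log ?_ ?_))
    · exact Continuous.div (by fun_prop) (by fun_prop) (fun z => (hB z).ne')
    · exact fun z => (div_pos (Real.exp_pos _) (hB z)).ne'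
  refine ⟨continuous_finsetSum _ fun c _ => hc c, ?_⟩
  unfold supervisedLoss
  congr 1
  rw [integral_finsetSum, Finset.mul_sum]
  · refine Finset.sum_congr rfl fun c _ => ?_
    rw [vmf_const κ (v c) (v c₀) (by rw [hv, hv])]
  · intro c _
    exact (hc c).integrable_of_hasCompactSupport (HasCompactSupport.of_compactSpace _)

/-- **Theorem 2 (identifiability of supervised classification).** If `(f, W, β)` globally
minimizes the supervised cross-entropy objective among all continuous encoders, linear
classifiers and positive temperatures, then `h = f ∘ g` is a linear map on the sphere:
there is an invertible linear map `A` with `h z = A⁻¹ z` for all `z ∈ S^{d-1}`. -/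
theorem supervised_identifiability
    {d D : ℕ} {Cset : Type} [Fintype Cset]
    (v : Cset → EuclideanSpace ℝ (Fin d))
    (hv_norm : ∀ c, ‖v c‖ = 1)
    (hv_gen : IsAffineGenerator v)
    (κ : ℝ) (hκ : 0 < κ)
    (g : Metric.sphere (0 : EuclideanSpace ℝ (Fin d)) 1 → EuclideanSpace ℝ (Fin D))
    (hg_cont : Continuous g) (hg_inj : Function.Injective g)
    (f : EuclideanSpace ℝ (Fin D) → EuclideanSpace ℝ (Fin d))
    (w : Cset → EuclideanSpace ℝ (Fin d)) (β : ℝ)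
    (hf_cont : Continuous f)
    (hβ : 0 < β)
    (hmin : ∀ (f' : EuclideanSpace ℝ (Fin D) → EuclideanSpace ℝ (Fin d))
      (w' : Cset → EuclideanSpace ℝ (Fin d)) (β' : ℝ), Continuous f' → 0 < β' →
      supervisedLoss d D v κ g f w β ≤ supervisedLoss d D v κ g f' w' β') :
    ∃ A : EuclideanSpace ℝ (Fin d) ≃ₗ[ℝ] EuclideanSpace ℝ (Fin d),
      ∀ z : Metric.sphere (0 : EuclideanSpace ℝ (Fin d)) 1,
        f (g z) = A.symm (z : EuclideanSpace ℝ (Fin d)) := by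
  obtain ⟨α, hα, -⟩ := hv_gen 0
  have hne : Nonempty Cset := by
    by_contra hn
    rw [not_nonempty_iff] at hn
    simp at hα
  obtain ⟨c₀⟩ := id hne
  haveI : IsFiniteMeasure (sphereUniform d) := by unfold sphereUniform; infer_instance
  haveI : (sphereUniform d).IsOpenPosMeasure := by unfold sphereUniform; infer_instance
  haveI : CompactSpace (Metric.sphere (0 : EuclideanSpace ℝ (Fin d)) 1) := inferInstance
  haveI : Nonempty (Metric.sphere (0 : EuclideanSpace ℝ (Fin d)) 1) :=
    ⟨⟨v c₀, by simp [hv_norm]⟩⟩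
  obtain ⟨f', hf'⟩ : ∃ f' : C(EuclideanSpace ℝ (Fin D), EuclideanSpace ℝ (Fin d)),
      ∀ z, f' (g z) = (z : EuclideanSpace ℝ (Fin d)) := by
    haveI : TietzeExtension.{0, 0} (EuclideanSpace ℝ (Fin d)) := TietzeExtension.of_tvs ℝ
    obtain ⟨f', hf'⟩ := ContinuousMap.exists_extension' (hg_cont.isClosedEmbedding hg_inj)
      (⟨Subtype.val, continuous_subtype_val⟩ :
        C(Metric.sphere (0 : EuclideanSpace ℝ (Fin d)) 1, EuclideanSpace ℝ (Fin d)))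
    exact ⟨f', fun z => congrFun hf' z⟩
  have hle := hmin f' v κ f'.continuous hκ
  obtain ⟨hF, hFe⟩ := loss_eq v hv_norm κ g hg_cont c₀ f hf_cont w β
  obtain ⟨hG, hGe⟩ := loss_eq v hv_norm κ g hg_cont c₀ f' f'.continuous v κ
  rw [hFe, hGe] at hle
  have hZ : 0 < ∫ z : Metric.sphere (0 : EuclideanSpace ℝ (Fin d)) 1,
      Real.exp (κ * ⟪v c₀, (z : EuclideanSpace ℝ (Fin d))⟫) ∂(sphereUniform d) := by
    refine Continuous.integral_pos_of_hasCompactSupport_nonneg_nonzero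
      (x := Classical.arbitrary _) (by fun_prop) (HasCompactSupport.of_compactSpace _)
      (fun z => (Real.exp_pos _).le) (Real.exp_pos _).ne'
  have hcard : (0 : ℝ) < (Fintype.card Cset : ℝ)⁻¹ := by
    have : 0 < Fintype.card Cset := Fintype.card_pos
    positivity
  have hle2 := le_of_mul_le_mul_left (le_of_mul_le_mul_left hle hcard) (inv_pos.mpr hZ)
  simp only [hf'] at hle2 hG
  have hgib := fun z : Metric.sphere (0 : EuclideanSpace ℝ (Fin d)) 1 =>
    gibbs_logits (fun c => κ * ⟪v c, (z : EuclideanSpace ℝ (Fin d))⟫)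
      (fun c => β * ⟪w c, f (g z)⟫)
  refine linear_step v w hv_gen κ β hκ c₀ (fun z => f (g z)) fun z c => ?_
  refine (hgib z).2 ?_ c c₀
  by_contra hneq
  have hpos := Continuous.integral_pos_of_hasCompactSupport_nonneg_nonzero
      (μ := sphereUniform d) (x := z) (hF.sub hG) (HasCompactSupport.of_compactSpace _)
      (fun z => sub_nonneg.mpr (hgib z).1) (sub_ne_zero.mpr (Ne.symm hneq))
  have hsub := integral_sub (μ := sphereUniform d)
    (hF.integrable_of_hasCompactSupport (HasCompactSupport.of_compactSpace _))
    (hG.integrable_of_hasCompactSupport (HasCompactSupport.of_compactSpace _))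
  have hpos' := hpos.trans_eq hsub
  linarith
end
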